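/- In the group algebra Q[S_{n+1}], with x_j the sum of all w with w(1)<...<w(j+1) for 0 <= j <= n and the convention x_{-1} = x_0, one has for all 0 <= j,k <= n: x_j * x_k = sum over l from -1 to min(j,k) of (n-j choose k-l)*(n-k choose j-l)*(n-j-k+l)! * x_l, where terms with n-j-k+l < 0 are zero. -/

import Mathlib

/-- In the group algebra `ℚ[S_N]` (permutations of `{0, 1, ..., N-1}`, corresponding to
`{1, ..., N}` in one-based indexing), `xA N j` is the sum of all permutations `w` with
`w 0 < w 1 < ... < w j`, i.e. the minimal-length left coset representatives of the
parabolic subgroup generated by the adjacent transpositions `s_1, ..., s_j`. -/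
noncomputable def xA (N j : ℕ) : MonoidAlgebra ℚ (Equiv.Perm (Fin N)) :=
  ∑ w ∈ Finset.univ.filter
      (fun w : Equiv.Perm (Fin N) => ∀ a b : Fin N, a < b → (b : ℕ) ≤ j → w a < w b),
    MonoidAlgebra.single w 1

open Polynomial in
/-- The expansion of a product of two falling factorials in falling factorials. -/
theorem descPochhammer_mul_descPochhammer (R : Type*) [CommRing R] (p q : ℕ) :
    descPochhammer R p * descPochhammer R q =
      ∑ i ∈ Finset.range (q + 1),
        ((p.choose i * q.choose i * i.factorial : ℕ) : R[X]) * descPochhammer R (p + q - i) := by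
  induction q with
  | zero => simp
  | succ q ih =>
    have key : ∀ i ∈ Finset.range (q + 1),
        ((p.choose i * q.choose i * i.factorial : ℕ) : R[X]) * descPochhammer R (p + q - i) *
            (X - (q : R[X])) =
          ((p.choose i * q.choose i * i.factorial : ℕ) : R[X]) *
              descPochhammer R (p + (q + 1) - i) +
            ((p.choose (i + 1) * q.choose i * (i + 1).factorial : ℕ) : R[X]) *
              descPochhammer R (p + (q + 1) - (i + 1)) := by
      intro i hi
      have hi : i ≤ q := by simpa [Nat.lt_succ_iff] using hi
      have h1 : p + (q + 1) - i = p + q - i + 1 := by omega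
      have h2 : p + (q + 1) - (i + 1) = p + q - i := by omega
      rw [h1, h2, descPochhammer_succ_right]
      rcases lt_or_ge p i with hp | hp
      · simp [Nat.choose_eq_zero_of_lt hp, Nat.choose_eq_zero_of_lt (hp.trans (Nat.lt_succ_self i))]
      have h3 : (p.choose (i + 1) : R[X]) * (i + 1) = p.choose i * (p - i) := by
        rw [← Nat.cast_sub hp]
        exact_mod_cast congrArg (Nat.cast (R := R[X])) (Nat.choose_succ_right_eq p i)
      rw [Nat.cast_sub (by omega : i ≤ p + q), Nat.factorial_succ]
      push_cast
      linear_combination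
        (-(q.choose i * i.factorial : R[X]) * descPochhammer R (p + q - i)) * h3
    rw [descPochhammer_succ_right, ← mul_assoc, ih, Finset.sum_mul, Finset.sum_congr rfl key,
      Finset.sum_add_distrib, Finset.sum_range_succ' _ (q + 1)]
    have h0 : ∑ i ∈ Finset.range (q + 1),
        ((p.choose i * q.choose i * i.factorial : ℕ) : R[X]) *
          descPochhammer R (p + (q + 1) - i) =
        ∑ i ∈ Finset.range (q + 1),
          ((p.choose (i + 1) * q.choose (i + 1) * (i + 1).factorial : ℕ) : R[X]) *
            descPochhammer R (p + (q + 1) - (i + 1)) + descPochhammer R (p + (q + 1)) := by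
      have h := Finset.sum_range_succ' (fun i =>
        ((p.choose i * q.choose i * i.factorial : ℕ) : R[X]) *
          descPochhammer R (p + (q + 1) - i)) (q + 1)
      rw [Finset.sum_range_succ] at h
      simpa using h
    rw [h0, add_right_comm, ← Finset.sum_add_distrib]
    congr 1
    · refine Finset.sum_congr rfl fun i _ => ?_
      rw [Nat.choose_succ_succ q i]
      push_cast
      ring
    · simp

/-- The permutation sending the last point to `c` and increasing on all the others. -/
def insertLast (n : ℕ) (c : Fin (n + 1)) : Equiv.Perm (Fin (n + 1)) :=
  (finSuccEquiv' (Fin.last n)).trans (finSuccEquiv' c).symm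

theorem insertLast_symm_self (n : ℕ) (c : Fin (n + 1)) :
    (insertLast n c).symm c = Fin.last n := by
  simp [insertLast]

theorem insertLast_symm_lt_iff (n : ℕ) {c x y : Fin (n + 1)} (hx : x ≠ c) (hy : y ≠ c) :
    (insertLast n c).symm x < (insertLast n c).symm y ↔ x < y := by
  obtain ⟨x, rfl⟩ := Fin.exists_succAbove_eq hx
  obtain ⟨y, rfl⟩ := Fin.exists_succAbove_eq hy
  simp [insertLast]

/-- The sum of all permutations increasing on all points but the last. -/
noncomputable def lastToRandom (n : ℕ) : MonoidAlgebra ℚ (Equiv.Perm (Fin (n + 1))) :=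
  ∑ c, MonoidAlgebra.single (insertLast n c) 1

theorem xA_coeff (N j : ℕ) (w : Equiv.Perm (Fin N)) :
    (xA N j).coeff w = if ∀ a b : Fin N, a < b → (b : ℕ) ≤ j → w a < w b then 1 else 0 := by
  classical
  simp [xA, Finsupp.single_apply]

theorem increasing_insertLast_inv_mul_iff (n j : ℕ) (hj : j ≤ n)
    (w : Equiv.Perm (Fin (n + 1))) (i : Fin (n + 1)) :
    (∀ a b : Fin (n + 1), a < b → (b : ℕ) ≤ j →
        ((insertLast n (w i))⁻¹ * w) a < ((insertLast n (w i))⁻¹ * w) b) ↔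
      (j < i ∧ ∀ a b : Fin (n + 1), a < b → (b : ℕ) ≤ j → w a < w b) ∨
      ((i : ℕ) = j ∧ ∀ a b : Fin (n + 1), a < b → (b : ℕ) ≤ j - 1 → w a < w b) := by
  simp only [Equiv.Perm.mul_apply, Equiv.Perm.inv_def]
  have hlt : ∀ {a b : Fin (n + 1)}, a ≠ i → b ≠ i →
      ((insertLast n (w i)).symm (w a) < (insertLast n (w i)).symm (w b) ↔ w a < w b) :=
    fun ha hb => insertLast_symm_lt_iff n (w.injective.ne ha) (w.injective.ne hb)
  rcases lt_trichotomy (i : ℕ) j with h | h | h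
  · refine iff_of_false (fun H => ?_) (by omega)
    have := H i ⟨j, by omega⟩ h le_rfl
    rw [insertLast_symm_self] at this
    exact absurd (Fin.le_last _) this.not_ge
  · simp only [h, lt_irrefl, false_and, true_and, false_or]
    constructor
    · intro H a b hab hb
      rw [Fin.lt_def] at hab
      refine (hlt ?_ ?_).1 (H a b hab (by omega)) <;> rintro rfl <;> omega
    · intro H a b hab hb
      have hab' := hab
      rw [Fin.lt_def] at hab'
      have ha : a ≠ i := by rintro rfl; omega
      by_cases hbi : b = i
      · subst hbi
        rw [insertLast_symm_self, Fin.lt_last_iff_ne_last, ← insertLast_symm_self n (w b)]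
        exact (Equiv.injective _).ne (w.injective.ne ha)
      · have : (b : ℕ) ≠ i := fun h => hbi (Fin.ext h)
        exact (hlt ha hbi).2 (H a b hab (by omega))
  · simp only [h, h.ne', true_and, false_and, or_false]
    refine forall₄_congr fun a b hab hb => ?_
    rw [Fin.lt_def] at hab
    exact hlt (by rintro rfl; omega) (by rintro rfl; omega)

theorem lastToRandom_mul_xA (n j : ℕ) (hj : j ≤ n) :
    lastToRandom n * xA (n + 1) j =
      ((n - j : ℕ) : ℚ) • xA (n + 1) j + xA (n + 1) (j - 1) := by
  classical
  ext w
  have hsum : (lastToRandom n * xA (n + 1) j).coeff w =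
      ∑ i, (xA (n + 1) j).coeff ((insertLast n (w i))⁻¹ * w) := by
    rw [lastToRandom, Finset.sum_mul, Equiv.sum_comp w fun c =>
      (xA (n + 1) j).coeff ((insertLast n c)⁻¹ * w)]
    simp [MonoidAlgebra.coeff_single_mul_apply]
  have hterm : ∀ i : Fin (n + 1), (xA (n + 1) j).coeff ((insertLast n (w i))⁻¹ * w) =
      (if (⟨j, by omega⟩ : Fin (n + 1)) < i then (xA (n + 1) j).coeff w else 0) +
        if (⟨j, by omega⟩ : Fin (n + 1)) = i then (xA (n + 1) (j - 1)).coeff w else 0 := by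
    intro i
    have hlt : (⟨j, by omega⟩ : Fin (n + 1)) < i ↔ j < (i : ℕ) := Iff.rfl
    have heq : (⟨j, by omega⟩ : Fin (n + 1)) = i ↔ (i : ℕ) = j := Fin.ext_iff.trans eq_comm
    simp only [xA_coeff, increasing_insertLast_inv_mul_iff n j hj w i, hlt, heq]
    rcases lt_trichotomy (i : ℕ) j with h | h | h
    · simp [h.ne, h.not_gt]
    · simp [h]
    · simp [h.ne', h]
  rw [hsum, Finset.sum_congr rfl fun i _ => hterm i, Finset.sum_add_distrib]
  simp [← Finset.sum_filter, Finset.filter_lt_eq_Ioi]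

theorem xA_self (n : ℕ) : xA (n + 1) n = 1 := by
  classical
  ext w
  rw [xA_coeff, MonoidAlgebra.one_def, MonoidAlgebra.coeff_single, Finsupp.single_apply]
  congr 1
  refine propext ⟨fun h => ?_, fun h => by subst h; simp +contextual⟩
  have hw : StrictMono w := fun a b hab => h a b hab (by omega)
  have := Subsingleton.elim (hw.orderIsoOfSurjective _ w.surjective) (OrderIso.refl _)
  ext a
  simpa using congrArg Fin.val (DFunLike.congr_fun this a).symm

open Polynomial in
theorem aeval_lastToRandom_descPochhammer_succ (n p : ℕ) :
    aeval (lastToRandom n) (descPochhammer ℚ (p + 1)) =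
      lastToRandom n * aeval (lastToRandom n) (descPochhammer ℚ p) -
        (p : ℚ) • aeval (lastToRandom n) (descPochhammer ℚ p) := by
  rw [descPochhammer_succ_right, mul_comm, sub_mul, map_sub, map_mul, map_mul, aeval_X,
    map_natCast, Nat.cast_smul_eq_nsmul, nsmul_eq_mul]

open Polynomial in
theorem aeval_lastToRandom_descPochhammer (n p : ℕ) (hp : p ≤ n + 1) :
    aeval (lastToRandom n) (descPochhammer ℚ p) = xA (n + 1) (n - p) := by
  induction p with
  | zero => simp [xA_self]
  | succ p ih =>
    rw [aeval_lastToRandom_descPochhammer_succ, ih (by omega),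
      lastToRandom_mul_xA n (n - p) (by omega), Nat.sub_sub_self (by omega), Nat.sub_sub,
      add_sub_cancel_left]

open Polynomial in
theorem aeval_lastToRandom_descPochhammer_eq_zero (n p : ℕ) (hp : n + 2 ≤ p) :
    aeval (lastToRandom n) (descPochhammer ℚ p) = 0 := by
  induction p, hp using Nat.le_induction with
  | base =>
    rw [aeval_lastToRandom_descPochhammer_succ, aeval_lastToRandom_descPochhammer n _ le_rfl,
      show n - (n + 1) = 0 by omega, lastToRandom_mul_xA n 0 (by omega)]
    simp [add_smul]
  | succ p _ ih => rw [aeval_lastToRandom_descPochhammer_succ, ih]; simp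

/-- Multiplication formula in `ℚ[S_{n+1}]`:
`x_j * x_k = ∑_{l=-1}^{min(j,k)} (n-j choose k-l)(n-k choose j-l)(n-j-k+l)! x_l`,
with the convention `x_{-1} = x_0` and where terms with `n-j-k+l < 0` vanish.
The sum is reindexed by `m = l + 1 ∈ {0, ..., min(j,k)+1}`; note that for `m = 0`
the index `m - 1 = 0 - 1 = 0` (natural subtraction) realizes `x_{-1} = x_0`. -/
theorem xA_mul_xA (n j k : ℕ) (hj : j ≤ n) (hk : k ≤ n) :
    xA (n + 1) j * xA (n + 1) k =
      ∑ m ∈ Finset.range (min j k + 2),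
        (if j + k + 1 ≤ n + m then
            (((n - j).choose (k + 1 - m) * (n - k).choose (j + 1 - m) *
              Nat.factorial (n + m - j - k - 1) : ℕ) : ℚ)
          else 0) • xA (n + 1) (m - 1) := by
  have h := congrArg (Polynomial.aeval (lastToRandom n))
    (descPochhammer_mul_descPochhammer ℚ (n - j) (n - k))
  simp only [map_mul, map_sum, map_natCast] at h
  rw [aeval_lastToRandom_descPochhammer n _ (by omega),
    aeval_lastToRandom_descPochhammer n _ (by omega), Nat.sub_sub_self hj,
    Nat.sub_sub_self hk] at h
  rw [h]
  symm
  simp only [ite_smul, zero_smul]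
  rw [← Finset.sum_filter]
  refine Finset.sum_of_injOn (fun m => n + m - j - k - 1) ?_ ?_ ?_ ?_
  · intro m hm m' hm' h
    simp only [Finset.coe_filter, Finset.mem_range, Set.mem_ofPred_eq] at hm hm' h
    omega
  · intro m hm
    simp only [Finset.coe_filter, Finset.mem_range, Set.mem_ofPred_eq] at hm
    simp only [Finset.coe_range, Set.mem_Iio]
    omega
  · intro i hi hi'
    simp only [Finset.mem_range] at hi
    rcases lt_or_ge (n - j) i with hji | hji
    · simp [Nat.choose_eq_zero_of_lt hji]
    rcases lt_or_ge (n + 1) (n - j + (n - k) - i) with hlt | hge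
    · rw [aeval_lastToRandom_descPochhammer_eq_zero n _ hlt, mul_zero]
    · refine absurd ⟨i + j + k + 1 - n, ?_, ?_⟩ hi'
      · simp only [Finset.coe_filter, Finset.mem_range, Set.mem_ofPred_eq]
        omega
      · simp only
        omega
  · intro m hm
    simp only [Finset.mem_filter, Finset.mem_range] at hm
    rw [aeval_lastToRandom_descPochhammer n _ (by omega), Nat.cast_smul_eq_nsmul, nsmul_eq_mul,
      Nat.choose_symm_of_eq_add (show n - j = (k + 1 - m) + (n + m - j - k - 1) by omega),
      Nat.choose_symm_of_eq_add (show n - k = (j + 1 - m) + (n + m - j - k - 1) by omega),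
      show n - (n - j + (n - k) - (n + m - j - k - 1)) = m - 1 by omega]
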